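/- (Cassini identity) Let a, b, c ≥ 1 be integers and let x ∈ ℂ with x ≠ 0 and x³ ≠ 1. Then for every integer n ≥ 1, (x² + x + 1)²·(BJ(n+1)·BJ(n-1) - BJ(n)²) = -(x² + x + 1)·Φ1·Φ2 + x^(n+1)·Θ·((Z(n) - x·Z(n-1)) - x⁻¹·(Z(n+1) - x·Z(n))) in H. -/

import Mathlib

noncomputable section

/-- The bihyperbolic numbers over `ℂ`: the group algebra of the Klein four-group
`(ZMod 2 × ZMod 2, +)` over `ℂ`.  Its `ℂ`-basis is `1, j1, j2, j3` with
`j1² = j2² = j3² = 1`, `j1*j2 = j3`, `j1*j3 = j2`, `j2*j3 = j1`. -/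
abbrev H : Type := AddMonoidAlgebra ℂ (ZMod 2 × ZMod 2)

def j1 : H := AddMonoidAlgebra.single (1, 0) 1
def j2 : H := AddMonoidAlgebra.single (0, 1) 1
def j3 : H := AddMonoidAlgebra.single (1, 1) 1

/-- The third-order Jacobsthal polynomial sequence (evaluated at `x : ℂ`). -/
def J (x : ℂ) : ℕ → ℂ
  | 0 => 0
  | 1 => 1
  | 2 => x - 1
  | n + 3 => (x - 1) * J x (n + 2) + (x - 1) * J x (n + 1) + x * J x n

/-- The generalized bihyperbolic third-order Jacobsthal polynomial
`BJ_n^{(a,b,c)}(x) = J_n(x) + J_{n+a}(x) j1 + J_{n+b}(x) j2 + J_{n+c}(x) j3`. -/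
def BJ (x : ℂ) (a b c n : ℕ) : H :=
  algebraMap ℂ H (J x n) + algebraMap ℂ H (J x (n + a)) * j1
    + algebraMap ℂ H (J x (n + b)) * j2 + algebraMap ℂ H (J x (n + c)) * j3

/-- `Θ(y) = 1 + y^a j1 + y^b j2 + y^c j3`; used for `Θ = Th x a b c`,
`Φ1 = Th ω1 a b c`, `Φ2 = Th ω2 a b c`. -/
def Th (y : ℂ) (a b c : ℕ) : H :=
  1 + algebraMap ℂ H (y ^ a) * j1 + algebraMap ℂ H (y ^ b) * j2
    + algebraMap ℂ H (y ^ c) * j3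

/-- `Z_n(x) = ((ω1 x - 1) ω1^n Φ1 - (ω2 x - 1) ω2^n Φ2) / (ω1 - ω2)`. -/
def Z (x ω1 ω2 : ℂ) (a b c n : ℕ) : H :=
  algebraMap ℂ H (ω1 - ω2)⁻¹ *
    (algebraMap ℂ H ((ω1 * x - 1) * ω1 ^ n) * Th ω1 a b c
      - algebraMap ℂ H ((ω2 * x - 1) * ω2 ^ n) * Th ω2 a b c)

/-- The Binet formula for `J`, cleared of denominators. -/
theorem J_binet (x ω1 ω2 : ℂ) (hω1 : ω1 ^ 2 + ω1 + 1 = 0) (hω2 : ω2 ^ 2 + ω2 + 1 = 0)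
    (hω : ω1 ≠ ω2) : ∀ n : ℕ, (x ^ 2 + x + 1) * J x n =
      x ^ (n + 1) - (ω1 - ω2)⁻¹ * ((ω1 * x - 1) * ω1 ^ n - (ω2 * x - 1) * ω2 ^ n) := by
  have hd : ω1 - ω2 ≠ 0 := sub_ne_zero.mpr hω
  have hsum : ω1 + ω2 = -1 := mul_left_cancel₀ hd (by linear_combination hω1 - hω2)
  intro n
  induction n using Nat.strong_induction_on with
  | _ n ih =>
    match n, ih with
    | 0, _ => simp only [J]; field_simp; ring
    | 1, _ =>
      simp only [J]; field_simp
      linear_combination (x * (ω1 - ω2)) * hsum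
    | 2, _ =>
      simp only [J]; field_simp
      linear_combination (x * (ω1 - 1) - 1) * hω1 - (x * (ω2 - 1) - 1) * hω2
    | k + 3, ih =>
      have h0 := ih k (by omega)
      have h1 := ih (k + 1) (by omega)
      have h2 := ih (k + 2) (by omega)
      simp only [J]
      linear_combination (x - 1) * h2 + (x - 1) * h1 + x * h0
        + (ω1 - ω2)⁻¹ * ((ω1 * x - 1) * ω1 ^ k * (ω1 - x) * hω1
          - (ω2 * x - 1) * ω2 ^ k * (ω2 - x) * hω2)

/-- The Binet formula for `BJ`, cleared of denominators. -/
theorem BJ_binet (a b c : ℕ) (x ω1 ω2 : ℂ) (hω1 : ω1 ^ 2 + ω1 + 1 = 0)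
    (hω2 : ω2 ^ 2 + ω2 + 1 = 0) (hω : ω1 ≠ ω2) (n : ℕ) :
    algebraMap ℂ H (x ^ 2 + x + 1) * BJ x a b c n =
      algebraMap ℂ H (x ^ (n + 1)) * Th x a b c - Z x ω1 ω2 a b c n := by
  have h (k : ℕ) := congrArg (algebraMap ℂ H) (J_binet x ω1 ω2 hω1 hω2 hω k)
  have h0 := h n
  have h1 := h (n + a)
  have h2 := h (n + b)
  have h3 := h (n + c)
  simp only [map_mul, map_sub, map_add, map_pow, map_one] at h0 h1 h2 h3
  simp only [BJ, Th, Z, map_mul, map_sub, map_add, map_pow, map_one]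
  linear_combination h0 + j1 * h1 + j2 * h2 + j3 * h3

/-- The Cassini identity for `Z`. -/
theorem Z_cassini (a b c : ℕ) (x ω1 ω2 : ℂ) (hω1 : ω1 ^ 2 + ω1 + 1 = 0)
    (hω2 : ω2 ^ 2 + ω2 + 1 = 0) (hω : ω1 ≠ ω2) (n : ℕ) :
    Z x ω1 ω2 a b c (n + 2) * Z x ω1 ω2 a b c n - Z x ω1 ω2 a b c (n + 1) ^ 2 =
      -(algebraMap ℂ H (x ^ 2 + x + 1) * (Th ω1 a b c * Th ω2 a b c)) := by
  have hd : ω1 - ω2 ≠ 0 := sub_ne_zero.mpr hω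
  have hsum : ω1 + ω2 = -1 := mul_left_cancel₀ hd (by linear_combination hω1 - hω2)
  have hprod : ω1 * ω2 = 1 := by linear_combination ω1 * hsum - hω1
  have hscalar : (ω1 - ω2)⁻¹ ^ 2 * (ω1 - ω2) ^ 2 * (ω1 ^ n * ω2 ^ n)
      * ((ω1 * x - 1) * (ω2 * x - 1)) = x ^ 2 + x + 1 := by
    rw [← mul_pow, ← mul_pow, inv_mul_cancel₀ hd, hprod]
    linear_combination x ^ 2 * hprod - x * hsum
  rw [← hscalar]
  simp only [Z, map_mul, map_sub, map_pow, map_one]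
  ring

theorem BJ_cassini (a b c : ℕ) (ha : 1 ≤ a) (hb : 1 ≤ b) (hc : 1 ≤ c) (x : ℂ) (hx0 : x ≠ 0) (hx : x ^ 3 ≠ 1)
    (ω1 ω2 : ℂ) (hω1 : ω1 ^ 2 + ω1 + 1 = 0) (hω2 : ω2 ^ 2 + ω2 + 1 = 0)
    (hω : ω1 ≠ ω2) (n : ℕ) (hn : 1 ≤ n) :
    algebraMap ℂ H ((x ^ 2 + x + 1) ^ 2) *
        (BJ x a b c (n + 1) * BJ x a b c (n - 1) - BJ x a b c n ^ 2) =
      -(algebraMap ℂ H (x ^ 2 + x + 1) * (Th ω1 a b c * Th ω2 a b c))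
      + algebraMap ℂ H (x ^ (n + 1)) * Th x a b c *
          ((Z x ω1 ω2 a b c n - algebraMap ℂ H x * Z x ω1 ω2 a b c (n - 1))
            - algebraMap ℂ H x⁻¹ *
              (Z x ω1 ω2 a b c (n + 1) - algebraMap ℂ H x * Z x ω1 ω2 a b c n)) := by
  obtain ⟨m, rfl⟩ : ∃ m, n = m + 1 := ⟨n - 1, by omega⟩
  rw [Nat.add_sub_cancel]
  have h0 := BJ_binet a b c x ω1 ω2 hω1 hω2 hω m
  have h1 := BJ_binet a b c x ω1 ω2 hω1 hω2 hω (m + 1)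
  have h2 := BJ_binet a b c x ω1 ω2 hω1 hω2 hω (m + 2)
  have hinv : algebraMap ℂ H x * algebraMap ℂ H x⁻¹ = 1 := by
    rw [← map_mul, mul_inv_cancel₀ hx0, map_one]
  have hfactor (s u v w : H) : s ^ 2 * (u * v - w ^ 2) = s * u * (s * v) - (s * w) ^ 2 := by
    ring
  rw [← Z_cassini a b c x ω1 ω2 hω1 hω2 hω m, map_pow, hfactor, h0, h1, h2]
  simp only [map_pow]
  linear_combination algebraMap ℂ H x ^ (m + 1) * Th x a b c *
    (Z x ω1 ω2 a b c (m + 2) - algebraMap ℂ H x * Z x ω1 ω2 a b c (m + 1)) * hinv
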